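/- Let n > 4 and for p ∈ [0; 1/2] let S_n have the Binomial distribution B(n, p), i.e. S_n is a sum of n independent Bernoulli(p) random variables. Set q = 1 − p and let Y = ⌊np²⌋ + π_{npq + {np²}}, where π_{npq+{np²}} is a Poisson random variable with parameter npq + {np²}, ⌊x⌋ and {x} denoting the integer and fractional parts of x. Then sup_{0 ≤ p ≤ 1/2} d_TV(S_n; Y) ≤ (2/√π)·(1 + 1/√e)/(√n − 2) + (2 + 4/√π)/(n − 2√n). -/

import Mathlib

open MeasureTheory ProbabilityTheory Filter

/-- The Poisson probability mass function with parameter `lam`. -/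
noncomputable def poissonPmf (lam : ℝ) (k : ℕ) : ℝ :=
  Real.exp (-lam) * lam ^ k / (Nat.factorial k : ℝ)

/-- The Binomial `B(n,p)` probability mass function. -/
noncomputable def binomPmf (n : ℕ) (p : ℝ) (k : ℕ) : ℝ :=
  (n.choose k : ℝ) * p ^ k * (1 - p) ^ (n - k)

/-- Total variation distance between two (sub-)probability mass functions on `ℕ`:
`sup_{A ⊆ ℕ} |P(X ∈ A) − P(Y ∈ A)|`. -/
noncomputable def tvDist (f g : ℕ → ℝ) : ℝ :=
  ⨆ A : Set ℕ, |(∑' k : A, f (k : ℕ)) - (∑' k : A, g (k : ℕ))|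

/-- The pmf of the shifted Poisson random variable `a + π_μ`. -/
noncomputable def shiftedPoissonPmf (a : ℕ) (mu : ℝ) (k : ℕ) : ℝ :=
  if a ≤ k then poissonPmf mu (k - a) else 0

open Finset

/-! ### Poisson weights -/

lemma poissonPmf_pos {mu : ℝ} (hmu : 0 < mu) (k : ℕ) : 0 < poissonPmf mu k := by
  unfold poissonPmf; positivity

lemma succ_mul_poissonPmf_succ (mu : ℝ) (k : ℕ) :
    ((k : ℝ) + 1) * poissonPmf mu (k + 1) = mu * poissonPmf mu k := by
  unfold poissonPmf
  rw [Nat.factorial_succ, pow_succ]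
  push_cast
  field_simp

lemma hasSum_poissonPmf (mu : ℝ) : HasSum (poissonPmf mu) 1 := by
  have h := (NormedSpace.expSeries_div_hasSum_exp mu).mul_left (Real.exp (-mu))
  rw [← Real.exp_eq_exp_ℝ, ← Real.exp_add, neg_add_cancel, Real.exp_zero] at h
  simp only [← mul_div_assoc] at h
  exact h

lemma natCast_mul_tail_poissonPmf_le {mu : ℝ} (hmu : 0 < mu) (k : ℕ) :
    k * ∑' j, poissonPmf mu (j + (k + 1)) ≤
      mu * (poissonPmf mu k + ∑' j, poissonPmf mu (j + (k + 1))) := by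
  have hs := (hasSum_poissonPmf mu).summable
  have hk := (summable_nat_add_iff k).2 hs
  have hk' := (summable_nat_add_iff (k + 1)).2 hs
  have hsplit : poissonPmf mu k + ∑' j, poissonPmf mu (j + (k + 1)) =
      ∑' j, poissonPmf mu (j + k) := by
    rw [hk.tsum_eq_zero_add, zero_add]
    simp only [add_assoc, add_comm 1 k]
  rw [hsplit, ← tsum_mul_left, ← tsum_mul_left]
  refine Summable.tsum_le_tsum (fun j => ?_) (hk'.mul_left _) (hk.mul_left _)
  rw [← succ_mul_poissonPmf_succ, ← add_assoc]
  refine mul_le_mul_of_nonneg_right ?_ (poissonPmf_pos hmu _).le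
  push_cast
  have : (0 : ℝ) ≤ j := j.cast_nonneg
  linarith

lemma mul_sum_range_poissonPmf_le {mu : ℝ} (hmu : 0 < mu) (k : ℕ) :
    mu * ∑ j ∈ range k, poissonPmf mu j ≤
      k * (∑ j ∈ range k, poissonPmf mu j + poissonPmf mu k) := by
  rw [← sum_range_succ, sum_range_succ', mul_add, mul_sum, mul_sum]
  refine le_add_of_le_of_nonneg (sum_le_sum fun j hj => ?_)
    (mul_nonneg k.cast_nonneg (poissonPmf_pos hmu _).le)
  rw [← succ_mul_poissonPmf_succ]
  refine mul_le_mul_of_nonneg_right ?_ (poissonPmf_pos hmu _).le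
  exact_mod_cast mem_range.1 hj

/-! ### The Stein equation for the Poisson law -/

/-- The Poisson probability of the set `A`. -/
noncomputable def poissonProb (mu : ℝ) (A : Set ℕ) : ℝ :=
  ∑' k, A.indicator (poissonPmf mu) k

lemma poissonProb_mem_Icc {mu : ℝ} (hmu : 0 < mu) (A : Set ℕ) :
    poissonProb mu A ∈ Set.Icc (0 : ℝ) 1 := by
  have hs := hasSum_poissonPmf mu
  refine ⟨tsum_nonneg fun k => Set.indicator_nonneg (fun j _ => (poissonPmf_pos hmu j).le) k, ?_⟩
  rw [← hs.tsum_eq]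
  exact (hs.summable.indicator A).tsum_le_tsum
    (fun k => Set.indicator_le_self' (fun j _ => (poissonPmf_pos hmu j).le) k) hs.summable

/-- Partial sums of the centred indicator of `A` against the Poisson weights. -/
noncomputable def steinSum (mu : ℝ) (A : Set ℕ) (k : ℕ) : ℝ :=
  ∑ j ∈ range k, poissonPmf mu j * (A.indicator 1 j - poissonProb mu A)

/-- The solution of the Poisson Stein equation for the indicator of `A`; it vanishes at `0`. -/
noncomputable def steinSol (mu : ℝ) (A : Set ℕ) (k : ℕ) : ℝ :=
  steinSum mu A k / (k * poissonPmf mu k)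

@[simp] lemma steinSol_zero (mu : ℝ) (A : Set ℕ) : steinSol mu A 0 = 0 := by
  simp [steinSol]

lemma steinSol_succ (mu : ℝ) (A : Set ℕ) (k : ℕ) :
    steinSol mu A (k + 1) = steinSum mu A (k + 1) / (mu * poissonPmf mu k) := by
  rw [steinSol, ← succ_mul_poissonPmf_succ]
  push_cast
  rfl

lemma steinSol_equation {mu : ℝ} (hmu : 0 < mu) (A : Set ℕ) (k : ℕ) :
    mu * steinSol mu A (k + 1) - k * steinSol mu A k =
      A.indicator 1 k - poissonProb mu A := by
  have hpos := poissonPmf_pos hmu k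
  have hk : k * steinSol mu A k = steinSum mu A k / poissonPmf mu k := by
    rcases Nat.eq_zero_or_pos k with rfl | h
    · simp [steinSum]
    · have : (k : ℝ) ≠ 0 := by exact_mod_cast h.ne'
      rw [steinSol]
      field_simp
  rw [hk, steinSol_succ, steinSum, sum_range_succ, ← steinSum]
  field_simp
  ring

lemma abs_stein_increment_aux {k mu a b e x F G : ℝ} (hk : 0 < k) (hx : 0 < x)
    (ha : 0 ≤ a) (haF : a ≤ F) (hb : 0 ≤ b) (hbG : b ≤ G) (he : 0 ≤ e) (he1 : e ≤ 1)
    (hmu : 0 < mu) (hsum : F + x + G = 1) (hG : k * G ≤ mu * (x + G))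
    (hF : mu * F ≤ k * (F + x)) :
    |k * (a + x * e - (a + x * e + b) * (F + x)) - mu * (a - (a + x * e + b) * F)| ≤ k * x := by
  have hexp : k * (a + x * e - (a + x * e + b) * (F + x)) - mu * (a - (a + x * e + b) * F) =
      e * x * (k * G + mu * F) - a * (mu * (x + G) - k * G) - b * (k * (F + x) - mu * F) := by
    obtain rfl : G = 1 - F - x := by linarith
    ring
  have hle : k * G + mu * F ≤ k := by
    have : k * (F + x + G) = k := by rw [hsum, mul_one]
    linarith
  have hnn : 0 ≤ k * G + mu * F := by
    have := mul_nonneg hk.le (hb.trans hbG)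
    have := mul_nonneg hmu.le (ha.trans haF)
    linarith
  have h1 : 0 ≤ a * (mu * (x + G) - k * G) := mul_nonneg ha (by linarith)
  have h2 : 0 ≤ b * (k * (F + x) - mu * F) := mul_nonneg hb (by linarith)
  have h3 : a * (mu * (x + G) - k * G) ≤ F * (mu * (x + G) - k * G) :=
    mul_le_mul_of_nonneg_right haF (by linarith)
  have h4 : b * (k * (F + x) - mu * F) ≤ G * (k * (F + x) - mu * F) :=
    mul_le_mul_of_nonneg_right hbG (by linarith)
  have h5 : x * (k * G + mu * F) ≤ x * k := mul_le_mul_of_nonneg_left hle hx.le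
  have h6 : e * (x * (k * G + mu * F)) ≤ 1 * (x * (k * G + mu * F)) :=
    mul_le_mul_of_nonneg_right he1 (mul_nonneg hx.le hnn)
  have h7 : 0 ≤ e * (x * (k * G + mu * F)) := mul_nonneg he (mul_nonneg hx.le hnn)
  rw [hexp, abs_le]
  constructor <;> nlinarith

/-- The increments of the Stein solution are at most `1 / mu`. -/
lemma abs_steinSol_succ_sub_le {mu : ℝ} (hmu : 0 < mu) (A : Set ℕ) (k : ℕ) :
    |steinSol mu A (k + 1) - steinSol mu A k| ≤ 1 / mu := by
  have hx := poissonPmf_pos hmu k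
  have hind (j : ℕ) : 0 ≤ A.indicator (1 : ℕ → ℝ) j ∧ A.indicator (1 : ℕ → ℝ) j ≤ 1 := by
    by_cases h : j ∈ A <;> simp [h]
  obtain ⟨hP0, hP1⟩ := poissonProb_mem_Icc hmu A
  rcases Nat.eq_zero_or_pos k with rfl | hkpos
  · have h := steinSol_equation hmu A 0
    obtain ⟨h0, h1⟩ := hind 0
    have hg : steinSol mu A 1 = (A.indicator 1 0 - poissonProb mu A) / mu := by
      rw [eq_div_iff hmu.ne', ← h]; simp [mul_comm]
    rw [steinSol_zero, sub_zero, zero_add, hg, abs_div, abs_of_pos hmu]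
    gcongr
    rw [abs_le]
    constructor <;> linarith
  have hk : (0 : ℝ) < k := by exact_mod_cast hkpos
  have hs := hasSum_poissonPmf mu
  have hs' := hs.summable.indicator A
  set F := ∑ j ∈ range k, poissonPmf mu j with hFdef
  set G := ∑' j, poissonPmf mu (j + (k + 1)) with hGdef
  set a := ∑ j ∈ range k, A.indicator (poissonPmf mu) j with hadef
  set b := ∑' j, A.indicator (poissonPmf mu) (j + (k + 1)) with hbdef
  set e := A.indicator (1 : ℕ → ℝ) k with hedef
  have hmul (j : ℕ) : A.indicator (poissonPmf mu) j =
      poissonPmf mu j * A.indicator (1 : ℕ → ℝ) j := by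
    by_cases h : j ∈ A <;> simp [h]
  have hnonneg (j : ℕ) : 0 ≤ A.indicator (poissonPmf mu) j :=
    Set.indicator_nonneg (fun i _ => (poissonPmf_pos hmu i).le) j
  have hle (j : ℕ) : A.indicator (poissonPmf mu) j ≤ poissonPmf mu j :=
    Set.indicator_le_self' (fun i _ => (poissonPmf_pos hmu i).le) j
  have hsum : F + poissonPmf mu k + G = 1 := by
    rw [← hs.tsum_eq, ← hs.summable.sum_add_tsum_nat_add (k + 1), sum_range_succ]
  have hP : poissonProb mu A = a + poissonPmf mu k * e + b := by
    rw [poissonProb, ← hs'.sum_add_tsum_nat_add (k + 1), sum_range_succ, hmul k]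
  have hTk : steinSum mu A k = a - (a + poissonPmf mu k * e + b) * F := by
    rw [steinSum, ← hP, hadef, hFdef, mul_sum, ← sum_sub_distrib]
    exact sum_congr rfl fun j _ => by rw [hmul]; ring
  have hTk' : steinSum mu A (k + 1) =
      a + poissonPmf mu k * e - (a + poissonPmf mu k * e + b) * (F + poissonPmf mu k) := by
    rw [steinSum, sum_range_succ, ← steinSum, hTk, hP]
    ring
  have key := abs_stein_increment_aux hk hx (sum_nonneg fun j _ => hnonneg j)
    (sum_le_sum fun j _ => hle j) (tsum_nonneg fun j => hnonneg (j + (k + 1)))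
    (Summable.tsum_le_tsum (fun j => hle (j + (k + 1))) ((summable_nat_add_iff (k + 1)).2 hs')
      ((summable_nat_add_iff (k + 1)).2 hs.summable)) (hind k).1 (hind k).2 hmu hsum
    (natCast_mul_tail_poissonPmf_le hmu k) (mul_sum_range_poissonPmf_le hmu k)
  rw [← hTk', ← hTk] at key
  have hdiff : steinSol mu A (k + 1) - steinSol mu A k =
      (k * steinSum mu A (k + 1) - mu * steinSum mu A k) / (mu * (k * poissonPmf mu k)) := by
    rw [steinSol_succ, steinSol]
    field_simp
  rw [hdiff, abs_div, abs_of_pos (by positivity : 0 < mu * (k * poissonPmf mu k)),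
    div_le_div_iff₀ (by positivity) hmu]
  nlinarith

/-! ### Binomial weights -/

lemma binomPmf_nonneg {n : ℕ} {p : ℝ} (hp : 0 ≤ p) (hp1 : p ≤ 1) (k : ℕ) :
    0 ≤ binomPmf n p k := by
  have : 0 ≤ 1 - p := by linarith
  unfold binomPmf; positivity

lemma binomPmf_eq_zero_of_lt {n k : ℕ} (p : ℝ) (h : n < k) : binomPmf n p k = 0 := by
  simp [binomPmf, Nat.choose_eq_zero_of_lt h]

lemma sum_binomPmf_mul_pow (n : ℕ) (p z : ℝ) :
    ∑ k ∈ range (n + 1), binomPmf n p k * z ^ k = (1 - p + p * z) ^ n := by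
  rw [add_comm (1 - p), add_pow]
  refine sum_congr rfl fun k _ => ?_
  rw [binomPmf, mul_pow]
  ring

lemma sum_binomPmf (n : ℕ) (p : ℝ) : ∑ k ∈ range (n + 1), binomPmf n p k = 1 := by
  simpa using sum_binomPmf_mul_pow n p 1

lemma eval_bernsteinPolynomial (n k : ℕ) (p : ℝ) :
    (bernsteinPolynomial ℝ n k).eval p = binomPmf n p k := by
  simp [bernsteinPolynomial, binomPmf]

lemma sum_binomPmf_mul_sq (n : ℕ) (p : ℝ) :
    ∑ k ∈ range (n + 1), binomPmf n p k * ((k : ℝ) - n * p) ^ 2 = n * p * (1 - p) := by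
  have h := congrArg (Polynomial.eval p) (bernsteinPolynomial.variance ℝ n)
  simp only [Polynomial.eval_finsetSum, Polynomial.eval_mul, Polynomial.eval_pow,
    Polynomial.eval_sub, Polynomial.eval_natCast, eval_bernsteinPolynomial, nsmul_eq_mul,
    Polynomial.eval_X, Polynomial.eval_one] at h
  rw [← h]
  exact sum_congr rfl fun k _ => by ring

lemma sum_binomPmf_mul_abs_le {n : ℕ} {p : ℝ} (hp : 0 ≤ p) (hp1 : p ≤ 1)
    (hv : 0 < n * p * (1 - p)) :
    ∑ k ∈ range (n + 1), binomPmf n p k * |(k : ℝ) - n * p| ≤ √(n * p * (1 - p)) := by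
  set r := √(n * p * (1 - p)) with hr
  have hrpos : 0 < r := Real.sqrt_pos.2 hv
  have hsq : r ^ 2 = n * p * (1 - p) := Real.sq_sqrt hv.le
  have habs (x : ℝ) : |x| ≤ x ^ 2 / (2 * r) + r / 2 := by
    rw [← sub_nonneg]
    have : x ^ 2 / (2 * r) + r / 2 - |x| = (|x| - r) ^ 2 / (2 * r) := by
      rw [← sq_abs x]; field_simp; ring
    rw [this]; positivity
  calc ∑ k ∈ range (n + 1), binomPmf n p k * |(k : ℝ) - n * p|
      ≤ ∑ k ∈ range (n + 1), binomPmf n p k * (((k : ℝ) - n * p) ^ 2 / (2 * r) + r / 2) :=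
        sum_le_sum fun k _ => mul_le_mul_of_nonneg_left (habs _) (binomPmf_nonneg hp hp1 k)
    _ = (∑ k ∈ range (n + 1), binomPmf n p k * ((k : ℝ) - n * p) ^ 2) / (2 * r) +
          (∑ k ∈ range (n + 1), binomPmf n p k) * (r / 2) := by
        rw [sum_div, sum_mul, ← sum_add_distrib]
        exact sum_congr rfl fun k _ => by ring
    _ = r := by
        rw [sum_binomPmf_mul_sq, sum_binomPmf, ← hsq]; field_simp; ring

lemma mul_sub_mul_binomPmf (n k : ℕ) (p : ℝ) (hk : k < n) :
    p * ((n : ℝ) - k) * binomPmf n p k = (1 - p) * ((k : ℝ) + 1) * binomPmf n p (k + 1) := by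
  have hc : (n.choose (k + 1) : ℝ) * (k + 1) = n.choose k * ((n : ℝ) - k) := by
    rw [← Nat.cast_sub hk.le]
    exact_mod_cast Nat.choose_succ_right_eq n k
  have hpow : (1 - p) ^ (n - k) = (1 - p) ^ (n - (k + 1)) * (1 - p) := by
    rw [← pow_succ]; congr 1; omega
  rw [binomPmf, binomPmf, hpow, pow_succ]
  linear_combination (-(p ^ k * p * (1 - p) ^ (n - (k + 1)) * (1 - p))) * hc

/-- The Stein identity of the binomial law. -/
lemma sum_binomPmf_stein (n : ℕ) (p : ℝ) (g : ℕ → ℝ) :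
    ∑ k ∈ range (n + 1), binomPmf n p k * (p * ((n : ℝ) - k) * g (k + 1)) =
      ∑ k ∈ range (n + 1), binomPmf n p k * ((1 - p) * k * g k) := by
  rw [sum_range_succ, sum_range_succ']
  simp only [sub_self, mul_zero, zero_mul, add_zero, Nat.cast_zero, Nat.cast_add, Nat.cast_one]
  refine sum_congr rfl fun k hk => ?_
  linear_combination g (k + 1) * mul_sub_mul_binomPmf n k p (mem_range.1 hk)

lemma exp_neg_le_quadratic {x : ℝ} (hx : 0 ≤ x) : Real.exp (-x) ≤ 1 - x + x ^ 2 / 2 := by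
  have h := Real.quadratic_le_exp_of_nonneg hx
  have hpos := Real.exp_pos (-x)
  have hmul : Real.exp (-x) * Real.exp x = 1 := by rw [← Real.exp_add]; simp
  have hq : 0 ≤ 1 - x + x ^ 2 / 2 := by nlinarith [sq_nonneg (x - 1)]
  have h1 : 1 ≤ (1 - x + x ^ 2 / 2) * Real.exp x := by
    nlinarith [mul_le_mul_of_nonneg_left h hq, sq_nonneg (x ^ 2)]
  nlinarith [mul_le_mul_of_nonneg_left h1 hpos.le]

/-- Chernoff bound for the lower tail of the binomial law. -/
lemma sum_binomPmf_lt_le {n a : ℕ} {p : ℝ} (hp : 0 ≤ p) (hp1 : p ≤ 1) (ha : (a : ℝ) ≤ n * p ^ 2) :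
    ∑ k ∈ range (n + 1) with k < a, binomPmf n p k ≤ Real.exp (-(n * p * (1 - p) ^ 2 / 2)) := by
  have hq : 0 ≤ 1 - p := by linarith
  set z := Real.exp (-(1 - p)) with hz
  have hzpow (k : ℕ) : z ^ k = Real.exp (-(1 - p) * k) := by
    rw [hz, ← Real.exp_nat_mul]; ring_nf
  have hbase : 1 - p + p * z ≤ Real.exp (-(p * ((1 - p) - (1 - p) ^ 2 / 2))) := by
    refine le_trans ?_ (Real.one_sub_le_exp_neg _)
    nlinarith [mul_le_mul_of_nonneg_left (exp_neg_le_quadratic hq) hp]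
  have hbase0 : 0 ≤ 1 - p + p * z := by positivity
  calc ∑ k ∈ range (n + 1) with k < a, binomPmf n p k
      ≤ ∑ k ∈ range (n + 1) with k < a,
          binomPmf n p k * (Real.exp ((1 - p) * (n * p ^ 2)) * z ^ k) := by
        refine sum_le_sum fun k hk => le_mul_of_one_le_right (binomPmf_nonneg hp hp1 k) ?_
        rw [hzpow, ← Real.exp_add, Real.one_le_exp_iff]
        have : (k : ℝ) ≤ a := by exact_mod_cast (mem_filter.1 hk).2.le
        nlinarith [mul_le_mul_of_nonneg_left (this.trans ha) hq]
    _ ≤ ∑ k ∈ range (n + 1), binomPmf n p k * (Real.exp ((1 - p) * (n * p ^ 2)) * z ^ k) :=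
        sum_le_sum_of_subset_of_nonneg (filter_subset _ _) fun k _ _ =>
          mul_nonneg (binomPmf_nonneg hp hp1 k) (by positivity)
    _ = Real.exp ((1 - p) * (n * p ^ 2)) * (1 - p + p * z) ^ n := by
        rw [← sum_binomPmf_mul_pow, mul_sum]
        exact sum_congr rfl fun k _ => by ring
    _ ≤ Real.exp ((1 - p) * (n * p ^ 2)) *
          Real.exp (-(p * ((1 - p) - (1 - p) ^ 2 / 2))) ^ n := by gcongr
    _ = Real.exp (-(n * p * (1 - p) ^ 2 / 2)) := by
        rw [← Real.exp_nat_mul, ← Real.exp_add]; ring_nf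

/-! ### Total variation distance -/

lemma tsum_subtype_binomPmf (n : ℕ) (p : ℝ) (A : Set ℕ) :
    ∑' k : A, binomPmf n p k = ∑ k ∈ range (n + 1), binomPmf n p k * A.indicator 1 k := by
  rw [tsum_subtype A, tsum_eq_sum (s := range (n + 1))]
  · refine sum_congr rfl fun k _ => ?_
    by_cases h : k ∈ A <;> simp [h]
  · intro k hk
    have : binomPmf n p k = 0 := binomPmf_eq_zero_of_lt p (by simpa using hk)
    by_cases h : k ∈ A <;> simp [h, this]

lemma tsum_subtype_shiftedPoissonPmf (a : ℕ) (mu : ℝ) (A : Set ℕ) :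
    ∑' k : A, shiftedPoissonPmf a mu k = poissonProb mu {j | j + a ∈ A} := by
  rw [tsum_subtype A, poissonProb, ← (add_left_injective a).tsum_eq]
  · refine tsum_congr fun j => ?_
    by_cases h : j + a ∈ A <;> simp [h, shiftedPoissonPmf, Set.indicator]
  · intro k hk
    have hk' : a ≤ k := by
      by_contra h
      refine hk ?_
      by_cases hA : k ∈ A <;> simp [hA, shiftedPoissonPmf, h]
    exact ⟨k - a, Nat.sub_add_cancel hk'⟩

/-- Stein bound for the distance between a binomial law and a shifted Poisson law of equal mean. -/
lemma tvDist_binomPmf_shiftedPoissonPmf_le {n a : ℕ} {p d : ℝ} (hp : 0 < p) (hp1 : p ≤ 1)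
    (hv : 0 < n * p * (1 - p)) (hd : 0 ≤ d) (ha : (a : ℝ) = n * p ^ 2 - d) :
    tvDist (binomPmf n p) (shiftedPoissonPmf a (n * p * (1 - p) + d)) ≤
      (p * √(n * p * (1 - p)) + d) / (n * p * (1 - p) + d) +
        ∑ k ∈ range (n + 1) with k < a, binomPmf n p k := by
  set mu := n * p * (1 - p) + d with hmudef
  have hmu : 0 < mu := by linarith
  refine ciSup_le fun A => ?_
  rw [tsum_subtype_binomPmf, tsum_subtype_shiftedPoissonPmf]
  set B : Set ℕ := {j | j + a ∈ A} with hB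
  set P := poissonProb mu B with hP
  obtain ⟨hP0, hP1⟩ := poissonProb_mem_Icc hmu B
  set g : ℕ → ℝ := fun k => steinSol mu B (k - a) with hg
  have hb := fun k => binomPmf_nonneg (n := n) hp.le hp1 k
  have hginc (k : ℕ) : |g (k + 1) - g k| ≤ 1 / mu := by
    simp only [hg]
    rcases lt_or_ge k a with h | h
    · rw [Nat.sub_eq_zero_of_le h, Nat.sub_eq_zero_of_le h.le, sub_self, abs_zero]
      positivity
    · rw [Nat.sub_add_comm h]
      exact abs_steinSol_succ_sub_le hmu B (k - a)
  have hsplit (k : ℕ) : A.indicator 1 k - P =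
      (mu * g (k + 1) - ((k : ℝ) - a) * g k) + if k < a then A.indicator 1 k - P else 0 := by
    simp only [hg]
    rcases lt_or_ge k a with h | h
    · rw [Nat.sub_eq_zero_of_le h, Nat.sub_eq_zero_of_le h.le, if_pos h, steinSol_zero]
      ring
    · rw [Nat.sub_add_comm h, if_neg h.not_gt, add_zero, ← Nat.cast_sub h,
        steinSol_equation hmu B (k - a)]
      congr 1
      have hmem : k - a ∈ B ↔ k ∈ A := by
        rw [hB, Set.mem_ofPred_eq, Nat.sub_add_cancel h]
      by_cases hA : k ∈ A
      · rw [Set.indicator_of_mem hA, Set.indicator_of_mem (hmem.2 hA)]; rfl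
      · rw [Set.indicator_of_notMem hA, Set.indicator_of_notMem (mt hmem.1 hA)]
  have hstein : ∑ k ∈ range (n + 1), binomPmf n p k * (mu * g (k + 1) - ((k : ℝ) - a) * g k) =
      ∑ k ∈ range (n + 1), binomPmf n p k * ((g (k + 1) - g k) * (p * ((k : ℝ) - n * p) + d)) := by
    rw [← sub_eq_zero, ← sub_eq_zero.2 (sum_binomPmf_stein n p g), ← sum_sub_distrib,
      ← sum_sub_distrib]
    refine sum_congr rfl fun k _ => ?_
    rw [ha, hmudef]
    ring
  have hmain : |∑ k ∈ range (n + 1),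
      binomPmf n p k * ((g (k + 1) - g k) * (p * ((k : ℝ) - n * p) + d))| ≤
      (p * √(n * p * (1 - p)) + d) / mu := by
    calc _ ≤ ∑ k ∈ range (n + 1), binomPmf n p k * (1 / mu * (p * |(k : ℝ) - n * p| + d)) := by
          refine (abs_sum_le_sum_abs _ _).trans (sum_le_sum fun k _ => ?_)
          rw [abs_mul, abs_of_nonneg (hb k), abs_mul]
          refine mul_le_mul_of_nonneg_left (mul_le_mul (hginc k) ?_ (abs_nonneg _)
            (by positivity)) (hb k)
          refine (abs_add_le _ _).trans ?_
          rw [abs_mul, abs_of_pos hp, abs_of_nonneg hd]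
      _ = (p * ∑ k ∈ range (n + 1), binomPmf n p k * |(k : ℝ) - n * p| +
            d * ∑ k ∈ range (n + 1), binomPmf n p k) / mu := by
          rw [mul_sum, mul_sum, ← sum_add_distrib, sum_div]
          exact sum_congr rfl fun k _ => by ring
      _ ≤ _ := by
          rw [sum_binomPmf, mul_one]
          gcongr
          exact sum_binomPmf_mul_abs_le hp.le hp1 hv
  have htail : |∑ k ∈ range (n + 1), binomPmf n p k *
      (if k < a then A.indicator 1 k - P else 0)| ≤
      ∑ k ∈ range (n + 1) with k < a, binomPmf n p k := by
    rw [sum_filter]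
    refine (abs_sum_le_sum_abs _ _).trans (sum_le_sum fun k _ => ?_)
    rw [abs_mul, abs_of_nonneg (hb k)]
    split_ifs with h
    · refine mul_le_of_le_one_right (hb k) ?_
      rw [abs_le]
      by_cases hA : k ∈ A <;> simp only [hA, Set.indicator, if_true, if_false, Pi.one_apply] <;>
        constructor <;> linarith
    · simp
  have hdecomp : ∑ k ∈ range (n + 1), binomPmf n p k * A.indicator 1 k - P =
      ∑ k ∈ range (n + 1), binomPmf n p k * ((g (k + 1) - g k) * (p * ((k : ℝ) - n * p) + d)) +
      ∑ k ∈ range (n + 1), binomPmf n p k * (if k < a then A.indicator 1 k - P else 0) := by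
    rw [← hstein, ← sum_add_distrib]
    simp only [← mul_add, ← hsplit]
    simp only [mul_sub, sum_sub_distrib, ← sum_mul, sum_binomPmf, one_mul]
  rw [hdecomp]
  exact (abs_add_le _ _).trans (add_le_add hmain htail)

lemma tvDist_self (f : ℕ → ℝ) : tvDist f f = 0 := by
  simp [tvDist]

lemma binomPmf_zero_right (n : ℕ) : binomPmf n 0 = shiftedPoissonPmf 0 0 := by
  funext k
  cases k <;> simp [binomPmf, shiftedPoissonPmf, poissonPmf]

/-! ### Numerical estimates -/

lemma mul_exp_neg_le {s : ℝ} (hs : 2 ≤ s) :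
    s * (s - 2) * Real.exp (-((s - 2) / 2)) ≤ 0.3 * s + 3 := by
  obtain ⟨u, rfl⟩ : ∃ u, s = 2 * u + 2 := ⟨(s - 2) / 2, by ring⟩
  have hu : 0 ≤ u := by linarith
  have h := Real.sum_le_exp_of_nonneg hu 4
  norm_num [sum_range_succ, Nat.factorial] at h
  rw [show (2 * u + 2 - 2) / 2 = u by ring, Real.exp_neg, ← div_eq_mul_inv,
    div_le_iff₀ (Real.exp_pos u)]
  refine le_trans ?_ (mul_le_mul_of_nonneg_left h (by linarith))
  nlinarith [mul_nonneg hu (sq_nonneg (u - 1.2)), sq_nonneg (u - 1.2), sq_nonneg (u ^ 2)]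

lemma mul_sqrt_div_le {s p mu : ℝ} (hs : 0 < s) (hp : 0 < p) (hp2 : p ≤ 1 / 2)
    (hmu : s ^ 2 * p * (1 - p) ≤ mu) :
    p * √(s ^ 2 * p * (1 - p)) / mu ≤ 1 / (2 * (1 - p) * s) := by
  have hq : 0 < 1 - p := by linarith
  have hpq : 0 < p * (1 - p) := mul_pos hp hq
  set r := √(p * (1 - p)) with hr
  have hr0 : 0 < r := Real.sqrt_pos.2 hpq
  have hr2 : r ^ 2 = p * (1 - p) := Real.sq_sqrt hpq.le
  have hrhalf : 2 * r ≤ 1 := by nlinarith [sq_nonneg (1 - 2 * p)]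
  have hsr : √(s ^ 2 * p * (1 - p)) = s * r := by
    rw [mul_assoc, Real.sqrt_mul (sq_nonneg s), Real.sqrt_sq hs.le]
  have hmu' : (s * r) ^ 2 ≤ mu := by rw [mul_pow, hr2, ← mul_assoc]; exact hmu
  rw [hsr, div_le_div_iff₀ (lt_of_lt_of_le (by positivity) hmu') (by positivity)]
  calc p * (s * r) * (2 * (1 - p) * s) = 2 * r * (s * r) ^ 2 := by
        rw [mul_pow, hr2]; ring
    _ ≤ 1 * (s * r) ^ 2 := by gcongr
    _ ≤ 1 * mu := by gcongr

lemma rational_le_bound {s : ℝ} (hs : 2 < s) :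
    (1.8 * s + 4) / (s * (s - 2)) ≤
      2 / √Real.pi * (1 + 1 / √(Real.exp 1)) / (s - 2) +
        (2 + 4 / √Real.pi) / (s ^ 2 - 2 * s) := by
  have hs2 : 0 < s - 2 := by linarith
  have hpi : 1.125 ≤ 2 / √Real.pi := by
    rw [le_div_iff₀ (Real.sqrt_pos.2 Real.pi_pos)]
    have : √Real.pi ≤ 16 / 9 := Real.sqrt_le_iff.2 ⟨by norm_num, by
      linarith [Real.pi_lt_d2]⟩
    linarith
  have he : 0.6 ≤ 1 / √(Real.exp 1) := by
    rw [le_div_iff₀ (Real.sqrt_pos.2 (Real.exp_pos 1))]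
    have : √(Real.exp 1) ≤ 5 / 3 := Real.sqrt_le_iff.2 ⟨by norm_num, by
      linarith [Real.exp_one_lt_d9]⟩
    linarith
  have h1 : 1.8 ≤ 2 / √Real.pi * (1 + 1 / √(Real.exp 1)) := by nlinarith
  have h2 : 4 ≤ 2 + 4 / √Real.pi := by
    have : 4 / √Real.pi = 2 * (2 / √Real.pi) := by ring
    linarith
  have hden : s ^ 2 - 2 * s = s * (s - 2) := by ring
  calc (1.8 * s + 4) / (s * (s - 2)) = 1.8 / (s - 2) + 4 / (s ^ 2 - 2 * s) := by
        rw [hden]; field_simp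
    _ ≤ _ := by
        have : 0 < s ^ 2 - 2 * s := by rw [hden]; positivity
        gcongr

/-- The estimate when the shift vanishes. -/
lemma bound_of_lt_inv {s p : ℝ} (hs : 2 < s) (hp2 : p ≤ 1 / 2) (hps : p * s ≤ 1) :
    1 / (2 * (1 - p) * s) + p ≤ (1.8 * s + 4) / (s * (s - 2)) := by
  have hq : 0 < 1 - p := by linarith
  have hs2 : 0 < s - 2 := by linarith
  have h1 : 1 / (2 * (1 - p) * s) ≤ 1 / (2 * (s - 1)) := by
    refine one_div_le_one_div_of_le (by linarith) ?_
    linarith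
  have h2 : p ≤ 1 / s := by rwa [le_div_iff₀ (by linarith)]
  have hs1 : 0 < s - 1 := by linarith
  have h3 : 1 / (2 * (s - 1)) + 1 / s ≤ (1.8 * s + 4) / (s * (s - 2)) := by
    rw [div_add_div _ _ (by positivity) (by positivity),
      div_le_div_iff₀ (by positivity) (by positivity)]
    have : (1 * s + 2 * (s - 1) * 1) * (s - 2) ≤ (1.8 * s + 4) * (2 * (s - 1)) := by nlinarith
    nlinarith [mul_le_mul_of_nonneg_left this (by linarith : 0 ≤ s)]
  linarith

/-- The estimate when the shift is positive. -/
lemma bound_of_inv_le {s p d : ℝ} (hs : 2 < s) (hp2 : p ≤ 1 / 2) (hps : 1 ≤ p * s)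
    (hd : 0 ≤ d) (hd1 : d ≤ 1) :
    1 / (2 * (1 - p) * s) + d / (s ^ 2 * p * (1 - p) + d) +
        Real.exp (-(s ^ 2 * p * (1 - p) ^ 2 / 2)) ≤ (1.8 * s + 4) / (s * (s - 2)) := by
  have hs0 : 0 < s := by linarith
  have hs2 : 0 < s - 2 := by linarith
  have hp : 0 < p := by by_contra h; nlinarith
  have hq : 0 < 1 - p := by linarith
  have hvpos : 0 < s ^ 2 * p * (1 - p) := by positivity
  have hdv : d / (s ^ 2 * p * (1 - p) + d) ≤ 1 / (s ^ 2 * p * (1 - p)) := by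
    rw [div_le_div_iff₀ (by linarith) hvpos]
    nlinarith
  have hexpo : s - 2 ≤ s ^ 2 * p * (1 - p) ^ 2 := by
    have hy : p * s ≤ s / 2 := by nlinarith
    have hpoly : s * (s - 2) ≤ p * s * (s - p * s) ^ 2 := by
      have hid : (s / 2 - 1) * (p * s * (s - p * s) ^ 2 - s * (s - 2)) =
          (s / 2 - 1) * ((p * s - 1) * (s / 2 - p * s) * (3 * s / 2 - 1 - p * s)) +
            ((s / 2 - p * s) + (p * s - 1) * (s * (s - 4) ^ 2 / 8)) := by ring
      have h1 : 0 ≤ p * s - 1 := by linarith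
      have h2 : 0 ≤ s / 2 - p * s := by linarith
      have h3 : 0 ≤ 3 * s / 2 - 1 - p * s := by linarith
      have h4 : 0 < s / 2 - 1 := by linarith
      have h5 : 0 ≤ (s / 2 - 1) * (p * s * (s - p * s) ^ 2 - s * (s - 2)) := by
        rw [hid]; positivity
      linarith [nonneg_of_mul_nonneg_right h5 h4]
    refine le_of_mul_le_mul_left (hpoly.trans_eq ?_) hs0
    ring
  have hE := mul_exp_neg_le hs.le
  have hexp : Real.exp (-(s ^ 2 * p * (1 - p) ^ 2 / 2)) ≤ (0.3 * s + 3) / (s * (s - 2)) := by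
    rw [le_div_iff₀ (by positivity), mul_comm]
    refine le_trans (mul_le_mul_of_nonneg_left (Real.exp_le_exp.2 ?_) (by positivity)) hE
    linarith
  have hinv : 1 / (s ^ 2 * p * (1 - p)) ≤ (1 - 2 * p + 2 / s) / ((1 - p) * s) := by
    rw [div_le_div_iff₀ hvpos (by positivity)]
    have : (1 - 2 * p + 2 / s) * (s ^ 2 * p * (1 - p)) =
        s * (1 - p) * (p * ((1 - 2 * p) * s + 2)) := by field_simp
    rw [this]
    nlinarith [mul_nonneg (mul_pos hs0 hq).le
      (mul_nonneg (sub_nonneg.2 hps) (by linarith : 0 ≤ 1 - 2 * p))]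
  have hsum : 1 / (2 * (1 - p) * s) + (1 - 2 * p + 2 / s) / ((1 - p) * s) ≤
      (1.5 * s + 1) / (s * (s - 2)) := by
    have : 1 / (2 * (1 - p) * s) + (1 - 2 * p + 2 / s) / ((1 - p) * s) =
        ((1.5 - 2 * p) * s + 2) / ((1 - p) * s ^ 2) := by
      field_simp; ring
    rw [this, div_le_div_iff₀ (by positivity) (by positivity)]
    have : ((1.5 - 2 * p) * s + 2) * (s - 2) ≤ (1.5 * s + 1) * (1 - p) * s := by
      nlinarith
    nlinarith [mul_le_mul_of_nonneg_left this hs0.le]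
  have htot : (1.5 * s + 1) / (s * (s - 2)) + (0.3 * s + 3) / (s * (s - 2)) =
      (1.8 * s + 4) / (s * (s - 2)) := by
    rw [← add_div]; ring_nf
  linarith

theorem stmt8 (n : ℕ) (hn : 4 < n) :
    (⨆ p : Set.Icc (0 : ℝ) (1 / 2),
        tvDist (binomPmf n p)
          (shiftedPoissonPmf ⌊n * (p : ℝ) ^ 2⌋₊
            (n * (p : ℝ) * (1 - (p : ℝ)) + Int.fract (n * (p : ℝ) ^ 2))))
      ≤ 2 / Real.sqrt Real.pi * (1 + 1 / Real.sqrt (Real.exp 1)) / (Real.sqrt n - 2)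
        + (2 + 4 / Real.sqrt Real.pi) / (n - 2 * Real.sqrt n) := by
  set s := √(n : ℝ) with hs
  have hsq : (n : ℝ) = s ^ 2 := (Real.sq_sqrt n.cast_nonneg).symm
  have hs2 : 2 < s := by
    rw [hs, Real.lt_sqrt (by norm_num)]
    norm_num
    exact_mod_cast hn
  have hs0 : 0 < s := by linarith
  have hRHS := rational_le_bound hs2
  rw [← hsq] at hRHS
  have : Nonempty (Set.Icc (0 : ℝ) (1 / 2)) := ⟨⟨0, by norm_num⟩⟩
  refine ciSup_le fun ⟨p, hp0, hp2⟩ => le_trans ?_ hRHS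
  rcases hp0.eq_or_lt with rfl | hp
  · have : 0 < s - 2 := by linarith
    simp only [ne_eq, OfNat.ofNat_ne_zero, not_false_eq_true, zero_pow, mul_zero, zero_mul,
      Nat.floor_zero, Int.fract_zero, add_zero, binomPmf_zero_right, tvDist_self]
    positivity
  have hq : 0 < 1 - p := by linarith
  set d := Int.fract ((n : ℝ) * p ^ 2) with hd
  have hd0 : 0 ≤ d := Int.fract_nonneg _
  have ha : (⌊(n : ℝ) * p ^ 2⌋₊ : ℝ) = n * p ^ 2 - d := by
    rw [natCast_floor_eq_intCast_floor (by positivity), hd, Int.fract]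
    ring
  have hv : 0 < n * p * (1 - p) := by rw [hsq]; positivity
  refine (tvDist_binomPmf_shiftedPoissonPmf_le hp (by linarith) hv hd0 ha).trans ?_
  have hmain : p * √(n * p * (1 - p)) / (n * p * (1 - p) + d) ≤ 1 / (2 * (1 - p) * s) := by
    rw [hsq]
    exact mul_sqrt_div_le hs0 hp hp2 (by linarith)
  rw [add_div]
  rcases lt_or_ge ((n : ℝ) * p ^ 2) 1 with hlt | hge
  · have hfloor : ⌊(n : ℝ) * p ^ 2⌋₊ = 0 := Nat.floor_eq_zero.2 hlt
    have hdeq : d = n * p ^ 2 := by rw [hfloor] at ha; push_cast at ha; linarith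
    have hdiv : d / (n * p * (1 - p) + d) = p := by
      rw [div_eq_iff (by linarith), hdeq]; ring
    have hps : p * s ≤ 1 := by rw [hsq] at hlt; nlinarith [mul_pos hp hs0]
    rw [hfloor, hdiv]
    simp only [not_lt_zero, filter_false, sum_empty, add_zero]
    linarith [bound_of_lt_inv hs2 hp2 hps]
  · have hps : 1 ≤ p * s := by rw [hsq] at hge; nlinarith [mul_pos hp hs0]
    have htail := sum_binomPmf_lt_le hp.le (by linarith : p ≤ 1)
      (by linarith : (⌊(n : ℝ) * p ^ 2⌋₊ : ℝ) ≤ n * p ^ 2)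
    have hbound := bound_of_inv_le hs2 hp2 hps hd0 (Int.fract_lt_one _).le
    rw [← hsq] at hbound
    linarith
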